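/- Let n ∈ {2,3}, let Ω ⊆ ℝⁿ be open, let ε > 0 and u ∈ C²(Ω) with S_ε(u) + 𝒲_ε(u) < ∞. Let 0 < r < R ≤ 1 and x ∈ Ω be such that the closed ball B_R(x) is contained in Ω. Then, writing B_ρ := B_ρ(x), one has r^{1−n} μ_ε(B_r) ≤ 3 R^{1−n} μ_ε(B_R) + 3 α_ε(B_R) + 2 ∫_r^R ξ_{ε,+}(B_ρ) ρ^{−n} dρ. -/

import Mathlib

open MeasureTheory Filter Metric Set

noncomputable section

abbrev E (n : ℕ) : Type := EuclideanSpace ℝ (Fin n)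

def W (t : ℝ) : ℝ := (t ^ 2 - 1) ^ 2 / 4

def W' (t : ℝ) : ℝ := t ^ 3 - t

def c0 : ℝ := 2 * Real.sqrt 2 / 3

def lap {n : ℕ} (u : E n → ℝ) (x : E n) : ℝ :=
  ∑ i, (fderiv ℝ (fderiv ℝ u) x) (EuclideanSpace.single i 1) (EuclideanSpace.single i 1)

def areaDensity {n : ℕ} (ev : ℝ) (u : E n → ℝ) (x : E n) : ℝ :=
  ev / 2 * ‖fderiv ℝ u x‖ ^ 2 + (1 / ev) * W (u x)

def willDensity {n : ℕ} (ev : ℝ) (u : E n → ℝ) (x : E n) : ℝ :=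
  (ev * lap u x - (1 / ev) * W' (u x)) ^ 2

def Se {n : ℕ} (ev : ℝ) (Ω : Set (E n)) (u : E n → ℝ) : ℝ :=
  (1 / c0) * ∫ x in Ω, areaDensity ev u x

def We {n : ℕ} (ev : ℝ) (Ω : Set (E n)) (u : E n → ℝ) : ℝ :=
  (1 / (c0 * ev)) * ∫ x in Ω, willDensity ev u x

def mue {n : ℕ} (ev : ℝ) (Ω : Set (E n)) (u : E n → ℝ) (U : Set (E n)) : ℝ :=
  (1 / c0) * ∫ x in U ∩ Ω, areaDensity ev u x

def ale {n : ℕ} (ev : ℝ) (Ω : Set (E n)) (u : E n → ℝ) (U : Set (E n)) : ℝ :=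
  (1 / (c0 * ev)) * ∫ x in U ∩ Ω, willDensity ev u x

def xiPlus {n : ℕ} (ev : ℝ) (Ω : Set (E n)) (u : E n → ℝ) (U : Set (E n)) : ℝ :=
  ∫ x in U ∩ Ω, max (ev / 2 * ‖fderiv ℝ u x‖ ^ 2 - (1 / ev) * W (u x)) 0

def sptM {n : ℕ} (μ : Measure (E n)) : Set (E n) :=
  {x | ∀ r > 0, 0 < μ (ball x r)}

def weakConvA {n : ℕ} (Ω : Set (E n)) (ε : ℕ → ℝ) (u : ℕ → E n → ℝ)
    (μ : Measure (E n)) : Prop :=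
  ∀ φ : BoundedContinuousFunction (E n) ℝ,
    Tendsto (fun k => (1 / c0) * ∫ x in Ω, φ x * areaDensity (ε k) (u k) x) atTop
      (nhds (∫ x, φ x ∂μ))

def weakConvW {n : ℕ} (Ω : Set (E n)) (ε : ℕ → ℝ) (u : ℕ → E n → ℝ)
    (α : Measure (E n)) : Prop :=
  ∀ φ : BoundedContinuousFunction (E n) ℝ,
    Tendsto (fun k => (1 / (c0 * ε k)) * ∫ x in Ω, φ x * willDensity (ε k) (u k) x) atTop
      (nhds (∫ x, φ x ∂α))

/-- Integration by parts of a `C¹` function against a compactly supported Lipschitz function. -/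
theorem integral_fderiv_mul_eq_neg_lineDeriv {n : ℕ} {f g : E n → ℝ} {C : NNReal}
    (hf : ContDiff ℝ 1 f) (hg : LipschitzWith C g) (hgc : HasCompactSupport g) (v : E n) :
    ∫ y, fderiv ℝ f y v * g y = - ∫ y, lineDeriv ℝ g y v * f y := by
  obtain ⟨ρ, hρ⟩ := hgc.isCompact.isBounded.subset_closedBall (0 : E n)
  let χ : ContDiffBump (0 : E n) := ⟨|ρ| + 1, |ρ| + 2, by positivity, by linarith⟩
  have hχf : ContDiff ℝ 1 (fun y => χ y * f y) := χ.contDiff.mul hf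
  have hχc : HasCompactSupport (fun y => χ y * f y) := χ.hasCompactSupport.mul_right
  obtain ⟨D, hD⟩ := hχf.lipschitzWith_of_hasCompactSupport hχc (by simp)
  have hχ : ∀ y ∈ tsupport g, (fun z => χ z * f z) =ᶠ[nhds y] f := by
    intro y hy
    have hy' : y ∈ ball (0 : E n) (|ρ| + 1) := by
      have := hρ hy
      rw [mem_closedBall] at this
      rw [mem_ball]
      linarith [le_abs_self ρ]
    filter_upwards [isOpen_ball.mem_nhds hy'] with z hz
    rw [χ.one_of_mem_closedBall (ball_subset_closedBall hz), one_mul]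
  have key := hD.integral_lineDeriv_mul_eq (μ := volume) hg hgc v
  have h1 : (fun y => lineDeriv ℝ (fun z => χ z * f z) y v * g y)
      = fun y => fderiv ℝ f y v * g y := by
    funext y
    by_cases hy : y ∈ tsupport g
    · rw [(hχf.differentiable (by simp) y).lineDeriv_eq_fderiv, (hχ y hy).fderiv_eq]
    · rw [image_eq_zero_of_notMem_tsupport hy, mul_zero, mul_zero]
  have h2 : (fun y => lineDeriv ℝ g y (-v) * (χ y * f y))
      = fun y => -(lineDeriv ℝ g y v * f y) := by
    funext y
    by_cases hy : y ∈ tsupport g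
    · rw [(hχ y hy).eq_of_nhds, lineDeriv_neg, neg_mul]
    · have : g =ᶠ[nhds y] fun _ => 0 := notMem_tsupport_iff_eventuallyEq.1 hy
      rw [this.lineDeriv_eq, this.lineDeriv_eq]
      simp [lineDeriv]
  rw [h1, h2, integral_neg] at key
  exact key

theorem norm_sq_eq_sum_apply_single {n : ℕ} (L : E n →L[ℝ] ℝ) :
    ‖L‖ ^ 2 = ∑ i, L (EuclideanSpace.single i 1) ^ 2 := by
  rw [← (InnerProductSpace.toDual ℝ (E n)).symm.norm_map L,
    ← (EuclideanSpace.basisFun (Fin n) ℝ).sum_sq_norm_inner_left]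
  refine Finset.sum_congr rfl fun i _ => ?_
  rw [InnerProductSpace.toDual_symm_apply]
  simp

theorem sum_coord_mul_apply_single {n : ℕ} {F : Type*} [NormedAddCommGroup F] [NormedSpace ℝ F]
    (L : E n →L[ℝ] F) (v : E n) : ∑ i, v i • L (EuclideanSpace.single i 1) = L v := by
  conv_rhs => rw [← (EuclideanSpace.basisFun (Fin n) ℝ).sum_repr v]
  simp

/-- The `i`-th component of the diffuse stress tensor contracted with the radial field. -/
def stressRadial {n : ℕ} (ε : ℝ) (u : E n → ℝ) (x : E n) (i : Fin n) (y : E n) : ℝ :=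
  areaDensity ε u y * (y i - x i) -
    ε * (fderiv ℝ u y (y - x) * fderiv ℝ u y (EuclideanSpace.single i 1))

theorem areaDensity_eq_sum {n : ℕ} (ε : ℝ) (u : E n → ℝ) :
    areaDensity ε u = fun y =>
      ε / 2 * ∑ i, fderiv ℝ u y (EuclideanSpace.single i 1) ^ 2 + (1 / ε) * W (u y) := by
  funext y
  rw [areaDensity, norm_sq_eq_sum_apply_single]

theorem contDiff_areaDensity {n : ℕ} (ε : ℝ) {u : E n → ℝ} (hu : ContDiff ℝ 2 u) :
    ContDiff ℝ 1 (areaDensity ε u) := by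
  have h1 : ContDiff ℝ 1 (fderiv ℝ u) := hu.fderiv_right (by norm_num)
  have h0 : ContDiff ℝ 1 u := hu.of_le (by norm_num)
  rw [areaDensity_eq_sum]
  unfold W
  fun_prop

theorem contDiff_stressRadial {n : ℕ} (ε : ℝ) {u : E n → ℝ} (hu : ContDiff ℝ 2 u) (x : E n)
    (i : Fin n) : ContDiff ℝ 1 (stressRadial ε u x i) := by
  have h1 : ContDiff ℝ 1 (fderiv ℝ u) := hu.fderiv_right (by norm_num)
  have h2 := contDiff_areaDensity ε hu
  have h3 : ContDiff ℝ 1 (fun y : E n => y i - x i) := by fun_prop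
  have h4 : ContDiff ℝ 1 (fun y : E n => fderiv ℝ u y (y - x)) :=
    h1.clm_apply (contDiff_id.sub contDiff_const)
  have h5 : ContDiff ℝ 1 (fun y : E n => fderiv ℝ u y (EuclideanSpace.single i 1)) :=
    h1.clm_apply contDiff_const
  exact (h2.mul h3).sub (contDiff_const.mul (h4.mul h5))

theorem fderiv_areaDensity {n : ℕ} (ε : ℝ) {u : E n → ℝ} (hu : ContDiff ℝ 2 u) (y v : E n) :
    fderiv ℝ (areaDensity ε u) y v =
      ε * ∑ i, fderiv ℝ u y (EuclideanSpace.single i 1) *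
        fderiv ℝ (fderiv ℝ u) y v (EuclideanSpace.single i 1) +
      (1 / ε) * (W' (u y) * fderiv ℝ u y v) := by
  have h1 : HasFDerivAt (fderiv ℝ u) (fderiv ℝ (fderiv ℝ u) y) y :=
    ((hu.fderiv_right (m := 1) (by norm_num)).differentiable (by simp) y).hasFDerivAt
  have h0 : HasFDerivAt u (fderiv ℝ u y) y := (hu.differentiable (by simp) y).hasFDerivAt
  have hi := fun i : Fin n =>
    HasFDerivAt.pow (h1.clm_apply (hasFDerivAt_const (EuclideanSpace.single i (1 : ℝ)) y)) 2
  have hs := HasFDerivAt.fun_sum (u := Finset.univ) fun i _ => hi i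
  have hW : HasDerivAt W (W' (u y)) (u y) := by
    have := (((hasDerivAt_id (u y)).pow 2).sub_const 1).pow 2 |>.div_const 4
    refine this.congr_deriv ?_
    simp [W']
    ring
  have h := (hs.const_mul (ε / 2)).add ((hW.comp_hasFDerivAt y h0).const_mul (1 / ε))
  rw [areaDensity_eq_sum]
  have h' := h.fderiv
  erw [h']
  simp [Finset.mul_sum]
  congr 1
  funext i
  ring

theorem fderiv_stressRadial {n : ℕ} (ε : ℝ) {u : E n → ℝ} (hu : ContDiff ℝ 2 u) (x y : E n)
    (i : Fin n) :
    fderiv ℝ (stressRadial ε u x i) y (EuclideanSpace.single i 1) =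
      areaDensity ε u y +
      (y - x) i * fderiv ℝ (areaDensity ε u) y (EuclideanSpace.single i 1) -
      ε * (fderiv ℝ u y (y - x) * fderiv ℝ (fderiv ℝ u) y
          (EuclideanSpace.single i 1) (EuclideanSpace.single i 1) +
        fderiv ℝ u y (EuclideanSpace.single i 1) *
          (fderiv ℝ (fderiv ℝ u) y (EuclideanSpace.single i 1) (y - x) +
            fderiv ℝ u y (EuclideanSpace.single i 1))) := by
  have h1 : HasFDerivAt (fderiv ℝ u) (fderiv ℝ (fderiv ℝ u) y) y :=
    ((hu.fderiv_right (m := 1) (by norm_num)).differentiable (by simp) y).hasFDerivAt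
  have h2 : HasFDerivAt (areaDensity ε u) (fderiv ℝ (areaDensity ε u) y) y :=
    ((contDiff_areaDensity ε hu).differentiable (by simp) y).hasFDerivAt
  have h3 : HasFDerivAt (fun y : E n => y i - x i) (EuclideanSpace.proj i : E n →L[ℝ] ℝ) y :=
    (EuclideanSpace.proj i : E n →L[ℝ] ℝ).hasFDerivAt.sub_const _
  have h4 := h1.clm_apply ((hasFDerivAt_id y).sub_const x)
  have h5 := h1.clm_apply (hasFDerivAt_const (EuclideanSpace.single i (1 : ℝ)) y)
  have h := (h2.mul h3).sub ((h4.mul h5).const_mul ε)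
  have h' := h.fderiv
  unfold stressRadial
  erw [h']
  simp
  ring

/-- The divergence of the diffuse stress tensor contracted with the radial field. -/
theorem sum_fderiv_stressRadial {n : ℕ} (ε : ℝ) {u : E n → ℝ} (hu : ContDiff ℝ 2 u)
    (x y : E n) :
    ∑ i, fderiv ℝ (stressRadial ε u x i) y (EuclideanSpace.single i 1) =
      n * areaDensity ε u y - ε * ‖fderiv ℝ u y‖ ^ 2 -
        (ε * lap u y - (1 / ε) * W' (u y)) * fderiv ℝ u y (y - x) := by
  have hsymm : IsSymmSndFDerivAt ℝ u y :=
    hu.contDiffAt.isSymmSndFDerivAt (by simp)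
  have hD := sum_coord_mul_apply_single (fderiv ℝ (areaDensity ε u) y) (y - x)
  simp only [smul_eq_mul] at hD
  have hS : ∑ i, fderiv ℝ u y (EuclideanSpace.single i 1) *
      fderiv ℝ (fderiv ℝ u) y (EuclideanSpace.single i 1) (y - x) =
      ∑ i, fderiv ℝ u y (EuclideanSpace.single i 1) *
      fderiv ℝ (fderiv ℝ u) y (y - x) (EuclideanSpace.single i 1) :=
    Finset.sum_congr rfl fun i _ => by rw [hsymm.eq]
  simp only [fderiv_stressRadial ε hu, Finset.sum_sub_distrib, Finset.sum_add_distrib, hD,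
    ← Finset.mul_sum, mul_add, hS]
  rw [fderiv_areaDensity ε hu, norm_sq_eq_sum_apply_single, lap]
  simp only [sq, Finset.sum_const, Finset.card_univ, Fintype.card_fin, nsmul_eq_mul]
  ring

theorem sum_stressRadial_mul {n : ℕ} (ε : ℝ) (u : E n → ℝ) (x y : E n) :
    ∑ i, (y - x) i * stressRadial ε u x i y =
      areaDensity ε u y * ‖y - x‖ ^ 2 - ε * fderiv ℝ u y (y - x) ^ 2 := by
  have hD := sum_coord_mul_apply_single (fderiv ℝ u y) (y - x)
  simp only [smul_eq_mul] at hD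
  have hterm : ∀ i, (y - x) i * stressRadial ε u x i y =
      areaDensity ε u y * (y - x) i ^ 2 - ε * fderiv ℝ u y (y - x) *
        ((y - x) i * fderiv ℝ u y (EuclideanSpace.single i 1)) := by
    intro i
    simp only [stressRadial, PiLp.sub_apply]
    ring
  simp only [hterm, Finset.sum_sub_distrib, ← Finset.mul_sum, hD]
  rw [EuclideanSpace.norm_sq_eq]
  simp only [Real.norm_eq_abs, sq_abs]
  ring

/-- The Lipschitz radial weight `|y - x|⁻ᵏ - R⁻ᵏ`, truncated at the radii `r` and `R`. -/
def radialWeight {n : ℕ} (k : ℕ) (r R : ℝ) (x y : E n) : ℝ :=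
  ((min (max ‖y - x‖ r) R) ^ k)⁻¹ - (R ^ k)⁻¹

section RadialWeight

variable {n k : ℕ} {r R : ℝ} {x y : E n}

theorem radialWeight_of_le (hrR : r ≤ R) (hy : ‖y - x‖ ≤ r) :
    radialWeight k r R x y = (r ^ k)⁻¹ - (R ^ k)⁻¹ := by
  rw [radialWeight, max_eq_right hy, min_eq_left hrR]

theorem radialWeight_of_mem (hy : r ≤ ‖y - x‖) (hy' : ‖y - x‖ ≤ R) :
    radialWeight k r R x y = (‖y - x‖ ^ k)⁻¹ - (R ^ k)⁻¹ := by
  rw [radialWeight, max_eq_left hy, min_eq_left hy']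

theorem radialWeight_of_ge (hy : R ≤ ‖y - x‖) : radialWeight k r R x y = 0 := by
  rw [radialWeight, min_eq_right (hy.trans (le_max_left _ _)), sub_self]

theorem radialWeight_nonneg (hr : 0 < r) (hrR : r < R) : 0 ≤ radialWeight k r R x y := by
  rw [radialWeight, sub_nonneg]
  have h : 0 < min (max ‖y - x‖ r) R :=
    lt_min (hr.trans_le (le_max_right _ _)) (hr.trans hrR)
  exact inv_anti₀ (pow_pos h k) (pow_le_pow_left₀ h.le (min_le_right _ _) k)

variable (x) in
theorem exists_lipschitzWith_radialWeight (hr : 0 < r) (hrR : r < R) :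
    ∃ C, LipschitzWith C (radialWeight k r R x) := by
  have hs : ContDiffOn ℝ 1 (fun s : ℝ => (s ^ k)⁻¹ - (R ^ k)⁻¹) (Icc r R) :=
    ((contDiffOn_id.pow k).inv fun s hs => pow_ne_zero k (hr.trans_le hs.1).ne').sub
      contDiffOn_const
  obtain ⟨C, hC⟩ := hs.exists_lipschitzOnWith (by simp) (convex_Icc r R) isCompact_Icc
  have hcl : LipschitzWith 1 (fun y : E n => min (max ‖y - x‖ r) R) := by
    have h : LipschitzWith 1 (fun y : E n => ‖y - x‖) := by
      refine LipschitzWith.mk_one fun a b => ?_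
      simpa [Real.dist_eq, dist_eq_norm] using abs_norm_sub_norm_le (a - x) (b - x)
    exact (h.max_const r).min_const R
  refine ⟨C * 1, ?_⟩
  rw [← lipschitzOnWith_univ]
  exact hC.comp (lipschitzOnWith_univ.2 hcl) fun y _ =>
    ⟨le_min (le_max_right _ _) hrR.le, min_le_right _ _⟩

variable (x) in
theorem hasCompactSupport_radialWeight : HasCompactSupport (radialWeight k r R x) := by
  refine HasCompactSupport.intro (isCompact_closedBall x R) fun y hy => radialWeight_of_ge ?_
  rw [mem_closedBall, dist_eq_norm, not_le] at hy
  exact hy.le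

theorem lineDeriv_radialWeight_of_lt (hrR : r < R) (hy : ‖y - x‖ < r) (v : E n) :
    lineDeriv ℝ (radialWeight k r R x) y v = 0 := by
  have h : radialWeight k r R x =ᶠ[nhds y] fun _ => (r ^ k)⁻¹ - (R ^ k)⁻¹ := by
    have : y ∈ {z : E n | ‖z - x‖ < r} := hy
    filter_upwards [(isOpen_lt (by fun_prop) continuous_const).mem_nhds this] with z hz
    exact radialWeight_of_le hrR.le (le_of_lt hz)
  rw [h.lineDeriv_eq]
  simp [lineDeriv]

theorem lineDeriv_radialWeight_of_gt (hy : R < ‖y - x‖) (v : E n) :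
    lineDeriv ℝ (radialWeight k r R x) y v = 0 := by
  have h : radialWeight k r R x =ᶠ[nhds y] fun _ => 0 := by
    have : y ∈ {z : E n | R < ‖z - x‖} := hy
    filter_upwards [(isOpen_lt continuous_const (by fun_prop)).mem_nhds this] with z hz
    exact radialWeight_of_ge (le_of_lt hz)
  rw [h.lineDeriv_eq]
  simp [lineDeriv]

theorem lineDeriv_radialWeight_of_mem (hr : 0 < r) (hy : r < ‖y - x‖) (hy' : ‖y - x‖ < R)
    (v : E n) : lineDeriv ℝ (radialWeight k r R x) y v =
      -(k * (‖y - x‖ ^ (k + 2))⁻¹ * inner ℝ (y - x) v) := by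
  have h : radialWeight k r R x =ᶠ[nhds y] fun z => (‖z - x‖ ^ k)⁻¹ - (R ^ k)⁻¹ := by
    have h1 : y ∈ {z : E n | r < ‖z - x‖} := hy
    have h2 : y ∈ {z : E n | ‖z - x‖ < R} := hy'
    filter_upwards [(isOpen_lt continuous_const (by fun_prop)).mem_nhds h1,
      (isOpen_lt (by fun_prop) continuous_const).mem_nhds h2] with z hz hz'
    exact radialWeight_of_mem (le_of_lt hz) (le_of_lt hz')
  rw [h.lineDeriv_eq]
  have hs : 0 < ‖y - x‖ := hr.trans hy
  have h1 : HasDerivAt (fun t : ℝ => y + t • v - x) v 0 := by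
    simpa using (((hasDerivAt_id (0 : ℝ)).smul_const v).const_add y).sub_const x
  have h2 := h1.norm_sq.sqrt (by simpa using hs.ne')
  simp only [Real.sqrt_sq (norm_nonneg _), zero_smul, add_zero] at h2
  have h3 := ((h2.fun_pow k).fun_inv (by simpa using pow_ne_zero k hs.ne')).sub_const (R ^ k)⁻¹
  rw [lineDeriv, h3.deriv]
  simp only [zero_smul, add_zero]
  rcases k with _ | k
  · simp
  · simp only [Nat.add_sub_cancel]
    field_simp
    ring

end RadialWeight

theorem inv_pow_mul_sq_le_one {k : ℕ} (hk : k ≤ 2) {s : ℝ} (hs : 0 < s) (hs1 : s ≤ 1) :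
    (s ^ k)⁻¹ * s ^ 2 ≤ 1 := by
  rw [inv_mul_le_one₀ (pow_pos hs k)]
  exact pow_le_pow_of_le_one hs.le hs1 hk

/-- Pointwise lower bound for the weighted divergence inside the small ball. -/
theorem lower_bound_inner {k : ℕ} (hk1 : 1 ≤ k) (hk2 : k ≤ 2) {ε r s q w v d g Q : ℝ}
    (hε : 0 < ε) (hr : 0 < r) (hr1 : r ≤ 1) (hs : s ≤ r) (hq : 0 ≤ q)
    (hw : 0 ≤ w) (hd : |d| ≤ q * s) (hg : 0 ≤ g) (hgQ : g = (r ^ k)⁻¹ - Q) (hQ : 0 ≤ Q) :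
    k * (2 / 3 * (r ^ k)⁻¹ * (ε / 2 * q ^ 2 + w)) -
      (k * Q * (ε / 2 * q ^ 2 + w) + g * max (ε / 2 * q ^ 2 - w) 0 + k * (3 / 2) * (v ^ 2 / ε)) ≤
    g * ((k + 1) * (ε / 2 * q ^ 2 + w) - ε * q ^ 2 - v * d) := by
  have hk : (1 : ℝ) ≤ k := by exact_mod_cast hk1
  have hP : 0 < (r ^ k)⁻¹ := inv_pos.2 (pow_pos hr k)
  have hP2 := inv_pow_mul_sq_le_one hk2 hr hr1
  set P := (r ^ k)⁻¹
  have hξ : g * (ε / 2 * q ^ 2 - w) ≤ g * max (ε / 2 * q ^ 2 - w) 0 :=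
    mul_le_mul_of_nonneg_left (le_max_left _ _) hg
  have hvd : v * d ≤ ε * q ^ 2 / 6 + 3 / 2 * r ^ 2 * (v ^ 2 / ε) := by
    have h1 : v * d ≤ |v| * (q * r) := by
      calc v * d ≤ |v * d| := le_abs_self _
        _ = |v| * |d| := abs_mul _ _
        _ ≤ |v| * (q * r) := by gcongr; exact hd.trans (by gcongr)
    have h2 : ε * q ^ 2 / 6 + 3 / 2 * r ^ 2 * (v ^ 2 / ε) - |v| * (q * r) =
        (ε * q - 3 * r * |v|) ^ 2 / (6 * ε) := by
      rw [← sq_abs v]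
      field_simp
      ring
    have h3 : 0 ≤ (ε * q - 3 * r * |v|) ^ 2 / (6 * ε) := by positivity
    linarith
  have hv : 0 ≤ v ^ 2 / ε := by positivity
  have hgP : g ≤ P := by linarith
  have hA : g * (v * d) ≤ P * (ε * q ^ 2 / 6) + 3 / 2 * (v ^ 2 / ε) := by
    calc g * (v * d) ≤ g * (ε * q ^ 2 / 6 + 3 / 2 * r ^ 2 * (v ^ 2 / ε)) := by gcongr
      _ ≤ P * (ε * q ^ 2 / 6 + 3 / 2 * r ^ 2 * (v ^ 2 / ε)) := by gcongr
      _ = P * (ε * q ^ 2 / 6) + 3 / 2 * (P * r ^ 2) * (v ^ 2 / ε) := by ring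
      _ ≤ P * (ε * q ^ 2 / 6) + 3 / 2 * 1 * (v ^ 2 / ε) := by gcongr
      _ = _ := by ring
  have hB : P * (ε * q ^ 2 / 6) + 3 / 2 * (v ^ 2 / ε) ≤
      k * (P * (1 / 3) * (ε / 2 * q ^ 2 + w) + 3 / 2 * (v ^ 2 / ε)) := by
    have h1 : P * (ε * q ^ 2 / 6) ≤ P * (1 / 3) * (ε / 2 * q ^ 2 + w) := by
      nlinarith [mul_nonneg hP.le hw]
    have h2 : 0 ≤ P * (1 / 3) * (ε / 2 * q ^ 2 + w) + 3 / 2 * (v ^ 2 / ε) := by positivity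
    nlinarith
  subst hgQ
  nlinarith

/-- Pointwise lower bound for the weighted divergence in the annulus. -/
theorem lower_bound_annulus {k : ℕ} (hk1 : 1 ≤ k) (hk2 : k ≤ 2) {ε s q w v d g Q : ℝ}
    (hε : 0 < ε) (hs : 0 < s) (hs1 : s ≤ 1) (hg : 0 ≤ g) (hgQ : g = (s ^ k)⁻¹ - Q)
    (hQ : 0 ≤ Q) :
    -(k * Q * (ε / 2 * q ^ 2 + w) + g * max (ε / 2 * q ^ 2 - w) 0 + k * (3 / 2) * (v ^ 2 / ε)) ≤
    g * ((k + 1) * (ε / 2 * q ^ 2 + w) - ε * q ^ 2 - v * d) -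
      k * (s ^ (k + 2))⁻¹ * ((ε / 2 * q ^ 2 + w) * s ^ 2 - ε * d ^ 2) := by
  have hk : (1 : ℝ) ≤ k := by exact_mod_cast hk1
  have hP : 0 < (s ^ k)⁻¹ := inv_pos.2 (pow_pos hs k)
  have hP2 := inv_pow_mul_sq_le_one hk2 hs hs1
  have hsplit : k * (s ^ (k + 2))⁻¹ * ((ε / 2 * q ^ 2 + w) * s ^ 2 - ε * d ^ 2) =
      k * (s ^ k)⁻¹ * (ε / 2 * q ^ 2 + w) - k * ((s ^ k)⁻¹ * (ε * (d ^ 2 / s ^ 2))) := by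
    rw [pow_add]
    field_simp
  rw [hsplit]
  set P := (s ^ k)⁻¹
  have hξ : g * (ε / 2 * q ^ 2 - w) ≤ g * max (ε / 2 * q ^ 2 - w) 0 :=
    mul_le_mul_of_nonneg_left (le_max_left _ _) hg
  have hvd : v * d ≤ ε * (d ^ 2 / s ^ 2) + 3 / 2 * s ^ 2 * (v ^ 2 / ε) := by
    have h2 : ε * (d ^ 2 / s ^ 2) + 1 / 4 * s ^ 2 * (v ^ 2 / ε) - v * d =
        (2 * ε * d - s ^ 2 * v) ^ 2 / (4 * ε * s ^ 2) := by
      field_simp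
      ring
    have h3 : 0 ≤ (2 * ε * d - s ^ 2 * v) ^ 2 / (4 * ε * s ^ 2) := by positivity
    have h4 : 0 ≤ s ^ 2 * (v ^ 2 / ε) := by positivity
    linarith
  have hv : 0 ≤ v ^ 2 / ε := by positivity
  have hgP : g ≤ P := by linarith
  have hD : 0 ≤ P * (ε * (d ^ 2 / s ^ 2)) := by positivity
  have hA : g * (v * d) ≤ P * (ε * (d ^ 2 / s ^ 2)) + 3 / 2 * (v ^ 2 / ε) := by
    calc g * (v * d) ≤ g * (ε * (d ^ 2 / s ^ 2) + 3 / 2 * s ^ 2 * (v ^ 2 / ε)) := by gcongr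
      _ ≤ P * (ε * (d ^ 2 / s ^ 2) + 3 / 2 * s ^ 2 * (v ^ 2 / ε)) := by gcongr
      _ = P * (ε * (d ^ 2 / s ^ 2)) + 3 / 2 * (P * s ^ 2) * (v ^ 2 / ε) := by ring
      _ ≤ P * (ε * (d ^ 2 / s ^ 2)) + 3 / 2 * 1 * (v ^ 2 / ε) := by gcongr
      _ = _ := by ring
  have hB : P * (ε * (d ^ 2 / s ^ 2)) + 3 / 2 * (v ^ 2 / ε) ≤
      k * (P * (ε * (d ^ 2 / s ^ 2)) + 3 / 2 * (v ^ 2 / ε)) := by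
    nlinarith
  subst hgQ
  nlinarith

/-- The first variation identity for the radial field weighted by `radialWeight`. -/
theorem integral_radialWeight_mul_div {n k : ℕ} (hn : n ≠ 0) {ε r R : ℝ} (hr : 0 < r)
    (hrR : r < R) {u : E n → ℝ} (hu : ContDiff ℝ 2 u) (x : E n) :
    ∫ y in ball x R, radialWeight k r R x y *
      (n * areaDensity ε u y - ε * ‖fderiv ℝ u y‖ ^ 2 -
        (ε * lap u y - (1 / ε) * W' (u y)) * fderiv ℝ u y (y - x)) =
    ∫ y in ball x R \ ball x r, k * (‖y - x‖ ^ (k + 2))⁻¹ *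
      (areaDensity ε u y * ‖y - x‖ ^ 2 - ε * fderiv ℝ u y (y - x) ^ 2) := by
  have : Nonempty (Fin n) := Fin.pos_iff_nonempty.1 (Nat.pos_of_ne_zero hn)
  obtain ⟨C, hC⟩ := exists_lipschitzWith_radialWeight (k := k) x hr hrR
  have hc := hasCompactSupport_radialWeight (k := k) (r := r) (R := R) x
  have hparts := fun i : Fin n => integral_fderiv_mul_eq_neg_lineDeriv
    (contDiff_stressRadial ε hu x i) hC hc (EuclideanSpace.single i 1)
  have hK : MeasurableSet (ball x R \ ball x r) := measurableSet_ball.diff measurableSet_ball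
  have hline : ∀ i : Fin n,
      -∫ y, lineDeriv ℝ (radialWeight k r R x) y (EuclideanSpace.single i 1) *
        stressRadial ε u x i y =
      ∫ y in ball x R \ ball x r, k * (‖y - x‖ ^ (k + 2))⁻¹ *
        ((y - x) i * stressRadial ε u x i y) := by
    intro i
    rw [← integral_neg, ← integral_indicator hK]
    have hr0 : ∀ᵐ y ∂(volume : Measure (E n)), y ∉ sphere x r :=
      compl_mem_ae_iff.2 (Measure.addHaar_sphere volume x r)
    have hR0 : ∀ᵐ y ∂(volume : Measure (E n)), y ∉ sphere x R :=
      compl_mem_ae_iff.2 (Measure.addHaar_sphere volume x R)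
    refine integral_congr_ae ?_
    filter_upwards [hr0, hR0] with y hyr hyR
    simp only [mem_sphere, dist_eq_norm] at hyr hyR
    rcases lt_or_gt_of_ne hyr with h | h
    · rw [lineDeriv_radialWeight_of_lt hrR h, indicator_of_notMem]
      · simp
      · simp [dist_eq_norm, h]
    rcases lt_or_gt_of_ne hyR with h' | h'
    · rw [lineDeriv_radialWeight_of_mem hr h h', indicator_of_mem]
      · rw [EuclideanSpace.inner_single_right]
        simp
        ring
      · simp [dist_eq_norm, h.le, h']
    · rw [lineDeriv_radialWeight_of_gt h', indicator_of_notMem]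
      · simp
      · simp [dist_eq_norm, h'.le]
  have hsum : ∑ i, ∫ y, fderiv ℝ (stressRadial ε u x i) y (EuclideanSpace.single i 1) *
      radialWeight k r R x y =
      ∑ i, ∫ y in ball x R \ ball x r, k * (‖y - x‖ ^ (k + 2))⁻¹ *
        ((y - x) i * stressRadial ε u x i y) :=
    Finset.sum_congr rfl fun i _ => (hparts i).trans (hline i)
  rw [← integral_finsetSum, ← integral_finsetSum] at hsum
  · simp only [← Finset.sum_mul, ← Finset.mul_sum, sum_fderiv_stressRadial ε hu,
      sum_stressRadial_mul] at hsum
    rw [← hsum]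
    rw [setIntegral_eq_integral_of_forall_compl_eq_zero]
    · simp only [mul_comm]
    · intro y hy
      rw [mem_ball, dist_eq_norm, not_lt] at hy
      rw [radialWeight_of_ge hy, zero_mul]
  · intro i _
    have hcl : IsCompact (closedBall x R \ ball x r) :=
      (isCompact_closedBall x R).diff isOpen_ball
    refine IntegrableOn.mono_set (ContinuousOn.integrableOn_compact hcl ?_)
      (sdiff_subset_sdiff_left ball_subset_closedBall)
    have hs := (contDiff_stressRadial ε hu x i).continuous
    refine ContinuousOn.mul (continuousOn_const.mul (ContinuousOn.inv₀ (by fun_prop) ?_))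
      (by fun_prop)
    intro y hy
    have : r ≤ ‖y - x‖ := by simpa [dist_eq_norm] using hy.2
    exact pow_ne_zero _ (hr.trans_le this).ne'
  · intro i _
    refine Continuous.integrable_of_hasCompactSupport ?_ hc.mul_left
    exact (((contDiff_stressRadial ε hu x i).continuous_fderiv (by simp)).clm_apply
      continuous_const).mul hC.continuous

theorem W_nonneg (t : ℝ) : 0 ≤ W t := by
  unfold W
  positivity

theorem continuous_lap {n : ℕ} {u : E n → ℝ} (hu : ContDiff ℝ 2 u) : Continuous (lap u) := by
  have h : Continuous (fderiv ℝ (fderiv ℝ u)) :=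
    (hu.fderiv_right (m := 1) (by norm_num)).continuous_fderiv (by simp)
  unfold lap
  fun_prop

theorem continuous_willDensity {n : ℕ} (ε : ℝ) {u : E n → ℝ} (hu : ContDiff ℝ 2 u) :
    Continuous (willDensity ε u) := by
  have h := continuous_lap hu
  have h0 := hu.continuous
  unfold willDensity W'
  fun_prop

/-- The positive part of the discrepancy density. -/
def discrepancyPos {n : ℕ} (ε : ℝ) (u : E n → ℝ) (y : E n) : ℝ :=
  max (ε / 2 * ‖fderiv ℝ u y‖ ^ 2 - (1 / ε) * W (u y)) 0

theorem continuous_discrepancyPos {n : ℕ} (ε : ℝ) {u : E n → ℝ} (hu : ContDiff ℝ 2 u) :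
    Continuous (discrepancyPos ε u) := by
  have h := hu.continuous_fderiv (by simp)
  have h0 := hu.continuous
  unfold discrepancyPos W
  fun_prop

theorem integrableOn_ball_of_continuous {n : ℕ} {f : E n → ℝ} (hf : Continuous f) (x : E n)
    (R : ℝ) : IntegrableOn f (ball x R) :=
  (hf.continuousOn.integrableOn_compact (isCompact_closedBall x R)).mono_set
    ball_subset_closedBall

/-- The almost-monotonicity inequality with the discrepancy weighted by `radialWeight`. -/
theorem area_le_of_contDiff {k : ℕ} (hk1 : 1 ≤ k) (hk2 : k ≤ 2) {ε r R : ℝ} (hε : 0 < ε)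
    (hr : 0 < r) (hrR : r < R) (hR : R ≤ 1) {u : E (k + 1) → ℝ} (hu : ContDiff ℝ 2 u)
    (x : E (k + 1)) :
    k * (2 / 3 * (r ^ k)⁻¹ * ∫ y in ball x r, areaDensity ε u y) ≤
      k * (R ^ k)⁻¹ * (∫ y in ball x R, areaDensity ε u y) +
      (∫ y in ball x R, radialWeight k r R x y * discrepancyPos ε u y) +
      k * (3 / 2) * ((1 / ε) * ∫ y in ball x R, willDensity ε u y) := by
  obtain ⟨C, hC⟩ := exists_lipschitzWith_radialWeight (k := k) x hr hrR
  have hf := (contDiff_areaDensity ε hu).continuous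
  have hwill := continuous_willDensity ε hu
  have hdis := continuous_discrepancyPos ε hu
  have hw := hC.continuous
  have hfd := hu.continuous_fderiv (by simp)
  have hlap := continuous_lap hu
  have hu0 := hu.continuous
  have hsub : ball x r ⊆ ball x R := ball_subset_ball hrR.le
  have hK : MeasurableSet (ball x R \ ball x r) := measurableSet_ball.diff measurableSet_ball
  have hQ : 0 ≤ (R ^ k)⁻¹ := inv_nonneg.2 (pow_nonneg (hr.trans hrR).le k)
  let P : E (k + 1) → ℝ := fun y => radialWeight k r R x y *
      (((k + 1 : ℕ) : ℝ) * areaDensity ε u y - ε * ‖fderiv ℝ u y‖ ^ 2 -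
        (ε * lap u y - (1 / ε) * W' (u y)) * fderiv ℝ u y (y - x))
  let S : E (k + 1) → ℝ := fun y => k * (‖y - x‖ ^ (k + 2))⁻¹ *
      (areaDensity ε u y * ‖y - x‖ ^ 2 - ε * fderiv ℝ u y (y - x) ^ 2)
  let H : E (k + 1) → ℝ := fun y => k * (R ^ k)⁻¹ * areaDensity ε u y +
      radialWeight k r R x y * discrepancyPos ε u y + k * (3 / 2) * ((1 / ε) * willDensity ε u y)
  have hPc : Continuous P := by
    have : Continuous fun y => fderiv ℝ u y (y - x) := by fun_prop
    have : Continuous W' := by unfold W'; fun_prop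
    fun_prop
  have hHc : Continuous H := by fun_prop
  have hSi : IntegrableOn S (ball x R \ ball x r) := by
    have hcl : IsCompact (closedBall x R \ ball x r) :=
      (isCompact_closedBall x R).diff isOpen_ball
    refine IntegrableOn.mono_set (ContinuousOn.integrableOn_compact hcl ?_)
      (sdiff_subset_sdiff_left ball_subset_closedBall)
    have : Continuous fun y => fderiv ℝ u y (y - x) := by fun_prop
    refine ContinuousOn.mul (continuousOn_const.mul (ContinuousOn.inv₀ (by fun_prop) ?_))
      (by fun_prop)
    intro y hy
    have : r ≤ ‖y - x‖ := by simpa [dist_eq_norm] using hy.2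
    exact pow_ne_zero _ (hr.trans_le this).ne'
  have hball : ∀ {g : E (k + 1) → ℝ}, Continuous g → IntegrableOn g (ball x R) :=
    fun hg => integrableOn_ball_of_continuous hg x R
  have hid : ∫ y in ball x R, P y = ∫ y in ball x R \ ball x r, S y :=
    integral_radialWeight_mul_div (k := k) (by simp) hr hrR hu x
  have hsplit : ∀ {g : E (k + 1) → ℝ}, Continuous g →
      ∫ y in ball x R, g y = (∫ y in ball x r, g y) + ∫ y in ball x R \ ball x r, g y := by
    intro g hg
    rw [setIntegral_sdiff measurableSet_ball (hball hg) hsub]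
    ring
  have hdiv : ∀ v : ℝ, 1 / ε * v ^ 2 = v ^ 2 / ε := fun v => by ring
  have hin : ∫ y in ball x r, (k * (2 / 3 * (r ^ k)⁻¹ * areaDensity ε u y) - H y) ≤
      ∫ y in ball x r, P y := by
    refine setIntegral_mono_on (IntegrableOn.mono_set (hball (by fun_prop)) hsub)
      ((hball hPc).mono_set hsub) measurableSet_ball fun y hy => ?_
    rw [mem_ball, dist_eq_norm] at hy
    have := lower_bound_inner hk1 hk2 (v := ε * lap u y - (1 / ε) * W' (u y)) hε hr
      (hrR.le.trans hR) hy.le (norm_nonneg (fderiv ℝ u y))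
      (mul_nonneg (one_div_pos.2 hε).le (W_nonneg (u y)))
      ((fderiv ℝ u y).le_opNorm (y - x)) (radialWeight_nonneg hr hrR)
      (radialWeight_of_le (k := k) hrR.le hy.le) hQ
    simp only [P, H, areaDensity, discrepancyPos, willDensity, hdiv, Nat.cast_add, Nat.cast_one]
    exact this
  have hann : ∫ y in ball x R \ ball x r, -H y ≤ ∫ y in ball x R \ ball x r, (P y - S y) := by
    refine setIntegral_mono_on ((hball hHc.neg).mono_set sdiff_subset)
      (((hball hPc).mono_set sdiff_subset).sub hSi) hK fun y hy => ?_
    have h1 : ‖y - x‖ < R := by simpa [dist_eq_norm] using hy.1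
    have h2 : r ≤ ‖y - x‖ := by simpa [dist_eq_norm] using hy.2
    have := lower_bound_annulus hk1 hk2 (v := ε * lap u y - (1 / ε) * W' (u y))
      (q := ‖fderiv ℝ u y‖) (w := 1 / ε * W (u y)) (d := fderiv ℝ u y (y - x)) hε
      (hr.trans_le h2) (h1.le.trans hR) (radialWeight_nonneg hr hrR)
      (radialWeight_of_mem (k := k) h2 h1.le) hQ
    simp only [P, S, H, areaDensity, discrepancyPos, willDensity, hdiv, Nat.cast_add,
      Nat.cast_one]
    exact this
  rw [integral_sub (IntegrableOn.mono_set (hball (by fun_prop)) hsub)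
    ((hball hHc).mono_set hsub)] at hin
  rw [integral_neg, integral_sub ((hball hPc).mono_set sdiff_subset) hSi] at hann
  have hP := hsplit hPc
  have hH := hsplit hHc
  have hHeq : ∫ y in ball x R, H y = k * (R ^ k)⁻¹ * (∫ y in ball x R, areaDensity ε u y) +
      (∫ y in ball x R, radialWeight k r R x y * discrepancyPos ε u y) +
      k * (3 / 2) * ((1 / ε) * ∫ y in ball x R, willDensity ε u y) := by
    simp only [H]
    rw [integral_add (hball (by fun_prop)) (hball (by fun_prop)),
      integral_add (hball (by fun_prop)) (hball (by fun_prop))]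
    simp only [integral_const_mul]
  simp only [integral_const_mul] at hin
  linarith

theorem setIntegral_Ioo_indicator_div_pow {n k : ℕ} (hk : k ≠ 0) {r R : ℝ} (hr : 0 < r)
    (hrR : r < R) {x y : E n} (hy : y ∈ ball x R) :
    ∫ ρ in Ioo r R, (if ‖y - x‖ < ρ then (ρ ^ (k + 1))⁻¹ else 0) =
      radialWeight k r R x y / k := by
  rw [mem_ball, dist_eq_norm] at hy
  set a := max ‖y - x‖ r with ha
  have har : r ≤ a := le_max_right _ _
  have haR : a < R := max_lt hy hrR
  have hset : Ioo r R ∩ {ρ | ‖y - x‖ < ρ} = Ioo a R := by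
    ext ρ
    simp only [mem_inter_iff, mem_Ioo, mem_ofPred_eq, ha, max_lt_iff]
    tauto
  have hm : MeasurableSet {ρ : ℝ | ‖y - x‖ < ρ} := measurableSet_Ioi
  have hind : (fun ρ : ℝ => if ‖y - x‖ < ρ then (ρ ^ (k + 1))⁻¹ else 0) =
      {ρ : ℝ | ‖y - x‖ < ρ}.indicator fun ρ => (ρ ^ (k + 1))⁻¹ := by
    funext ρ
    simp [indicator_apply]
  rw [hind, setIntegral_indicator hm, hset, ← integral_Ioc_eq_integral_Ioo,
    ← intervalIntegral.integral_of_le haR.le]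
  have hder : ∀ ρ ∈ uIcc a R,
      HasDerivAt (fun s : ℝ => -(s ^ k)⁻¹ / k) ((ρ ^ (k + 1))⁻¹) ρ := by
    intro ρ hρ
    rw [uIcc_of_le haR.le] at hρ
    have hρ0 : ρ ≠ 0 := (hr.trans_le (har.trans hρ.1)).ne'
    have h := (((hasDerivAt_pow k ρ).fun_inv (pow_ne_zero k hρ0)).fun_neg).div_const (k : ℝ)
    refine h.congr_deriv ?_
    obtain ⟨m, rfl⟩ := Nat.exists_eq_succ_of_ne_zero hk
    have : ((m.succ : ℕ) : ℝ) ≠ 0 := by positivity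
    simp only [Nat.succ_eq_add_one, Nat.add_sub_cancel]
    field_simp
    ring
  rw [intervalIntegral.integral_eq_sub_of_hasDerivAt hder]
  · rw [radialWeight, ← ha, min_eq_left haR.le]
    ring
  · refine ContinuousOn.intervalIntegrable (ContinuousOn.inv₀ (by fun_prop) ?_)
    intro ρ hρ
    rw [uIcc_of_le haR.le] at hρ
    exact pow_ne_zero _ (hr.trans_le (har.trans hρ.1)).ne'

/-- The layer-cake form of the integral weighted by `radialWeight`. -/
theorem setIntegral_Ioo_setIntegral_ball_div_pow {n k : ℕ} (hk : k ≠ 0) {r R : ℝ} (hr : 0 < r)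
    (hrR : r < R) (x : E n) {g : E n → ℝ} (hg : Continuous g) :
    ∫ ρ in Ioo r R, (∫ y in ball x ρ, g y) / ρ ^ (k + 1) =
      (∫ y in ball x R, radialWeight k r R x y * g y) / k := by
  let F : ℝ → E n → ℝ := fun ρ y => (if ‖y - x‖ < ρ then (ρ ^ (k + 1))⁻¹ else 0) * g y
  have hleft : ∀ ρ ∈ Ioo r R, (∫ y in ball x ρ, g y) / ρ ^ (k + 1) =
      ∫ y in ball x R, F ρ y := by
    intro ρ hρ
    have hF : F ρ = (ball x ρ).indicator fun y => (ρ ^ (k + 1))⁻¹ * g y := by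
      funext y
      by_cases h : ‖y - x‖ < ρ
      · rw [indicator_of_mem (by rwa [mem_ball, dist_eq_norm])]
        simp [F, h]
      · rw [indicator_of_notMem (by rwa [mem_ball, dist_eq_norm])]
        simp [F, h]
    rw [hF, setIntegral_indicator measurableSet_ball,
      inter_eq_right.2 (ball_subset_ball hρ.2.le), integral_const_mul]
    ring
  rw [setIntegral_congr_fun measurableSet_Ioo hleft, integral_integral_swap]
  · rw [← integral_div]
    refine setIntegral_congr_fun measurableSet_ball fun y hy => ?_
    simp only [F]
    rw [integral_mul_const, setIntegral_Ioo_indicator_div_pow hk hr hrR hy]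
    ring
  · obtain ⟨B, hB⟩ := (isCompact_closedBall x R).exists_bound_of_continuousOn hg.continuousOn
    have hfin : IsFiniteMeasure (volume.restrict (ball x R)) :=
      ⟨by simpa using measure_ball_lt_top⟩
    have hmeas : Measurable (Function.uncurry F) := by
      refine Measurable.mul ?_ (hg.measurable.comp measurable_snd)
      refine Measurable.ite (measurableSet_lt (by fun_prop) (by fun_prop)) (by fun_prop)
        measurable_const
    refine Integrable.of_bound hmeas.aestronglyMeasurable ((r ^ (k + 1))⁻¹ * B) ?_
    rw [Measure.prod_restrict]
    filter_upwards [ae_restrict_mem (measurableSet_Ioo.prod measurableSet_ball)] with p hp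
    have hp1 : r < p.1 := hp.1.1
    have hB' := hB p.2 (ball_subset_closedBall hp.2)
    rw [Function.uncurry, norm_mul]
    refine mul_le_mul ?_ hB' (norm_nonneg _) (by positivity)
    have hr1 : (p.1 ^ (k + 1))⁻¹ ≤ (r ^ (k + 1))⁻¹ :=
      inv_anti₀ (by positivity) (pow_le_pow_left₀ hr.le hp1.le _)
    have hp0 : 0 ≤ (p.1 ^ (k + 1))⁻¹ := inv_nonneg.2 (pow_nonneg (hr.trans hp1).le _)
    split_ifs
    · rwa [Real.norm_of_nonneg hp0]
    · rw [norm_zero]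
      positivity

/-- A function that is `C²` near a closed ball agrees near that ball with a global `C²` one. -/
theorem exists_contDiff_eventuallyEq_closedBall {n : ℕ} {Ω : Set (E n)} (hΩ : IsOpen Ω)
    {u : E n → ℝ} (hu : ContDiffOn ℝ 2 u Ω) {x : E n} {R : ℝ} (hR : 0 < R)
    (hball : closedBall x R ⊆ Ω) :
    ∃ w : E n → ℝ, ContDiff ℝ 2 w ∧ ∀ y ∈ closedBall x R, w =ᶠ[nhds y] u := by
  obtain ⟨δ, hδ, hδΩ⟩ := (isCompact_closedBall x R).exists_cthickening_subset_open hΩ hball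
  rw [cthickening_closedBall hδ.le hR.le] at hδΩ
  let χ : ContDiffBump x := ⟨R + δ / 2, δ + R, by positivity, by linarith⟩
  refine ⟨fun y => χ y * u y, ?_, fun y hy => ?_⟩
  · rw [contDiff_iff_contDiffAt]
    intro y
    by_cases hy : y ∈ Ω
    · exact χ.contDiff.contDiffAt.mul (hu.contDiffAt (hΩ.mem_nhds hy))
    · have hy' : y ∉ tsupport χ := by
        rw [χ.tsupport_eq]
        exact fun h => hy (hδΩ h)
      refine (contDiffAt_const (c := (0 : ℝ))).congr_of_eventuallyEq ?_
      filter_upwards [notMem_tsupport_iff_eventuallyEq.1 hy'] with z hz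
      simp [hz]
  · have hy' : y ∈ ball x (R + δ / 2) :=
      closedBall_subset_ball (by linarith) hy
    filter_upwards [isOpen_ball.mem_nhds hy'] with z hz
    rw [χ.one_of_mem_closedBall (ball_subset_closedBall hz), one_mul]

theorem three_quarters_le_c0 : 3 / 4 ≤ c0 := by
  have h : (9 / 8 : ℝ) ≤ Real.sqrt 2 := Real.le_sqrt_of_sq_le (by norm_num)
  unfold c0
  linarith

theorem stmt5 (n : ℕ) (hn : n = 2 ∨ n = 3) (Ω : Set (E n)) (hΩo : IsOpen Ω)
    (ε : ℝ) (hε : 0 < ε) (u : E n → ℝ) (hu : ContDiffOn ℝ 2 u Ω)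
    (hintS : IntegrableOn (areaDensity ε u) Ω)
    (hintW : IntegrableOn (willDensity ε u) Ω)
    (r R : ℝ) (hr : 0 < r) (hrR : r < R) (hR : R ≤ 1)
    (x : E n) (hball : closedBall x R ⊆ Ω) :
    r ^ ((1 : ℤ) - n) * mue ε Ω u (ball x r) ≤
      3 * R ^ ((1 : ℤ) - n) * mue ε Ω u (ball x R) + 3 * ale ε Ω u (ball x R) +
        2 * ∫ ρ in Set.Ioo r R, xiPlus ε Ω u (ball x ρ) / ρ ^ n := by
  obtain ⟨k, rfl, hk1, hk2⟩ : ∃ k, n = k + 1 ∧ 1 ≤ k ∧ k ≤ 2 := by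
    rcases hn with rfl | rfl
    exacts [⟨1, rfl, le_rfl, by norm_num⟩, ⟨2, rfl, by norm_num, le_rfl⟩]
  obtain ⟨w, hw, hwu⟩ := exists_contDiff_eventuallyEq_closedBall hΩo hu (hr.trans hrR) hball
  have hk : (1 : ℝ) ≤ k := by exact_mod_cast hk1
  have harea : ∀ y ∈ closedBall x R, areaDensity ε u y = areaDensity ε w y := fun y hy => by
    rw [areaDensity, areaDensity, (hwu y hy).fderiv_eq, (hwu y hy).eq_of_nhds]
  have hwill : ∀ y ∈ closedBall x R, willDensity ε u y = willDensity ε w y := fun y hy => by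
    rw [willDensity, willDensity, lap, lap, (hwu y hy).fderiv.fderiv_eq, (hwu y hy).eq_of_nhds]
  have hdis : ∀ y ∈ closedBall x R, discrepancyPos ε u y = discrepancyPos ε w y :=
    fun y hy => by
      rw [discrepancyPos, discrepancyPos, (hwu y hy).fderiv_eq, (hwu y hy).eq_of_nhds]
  have hsub : ∀ ρ ≤ R, ball x ρ ⊆ closedBall x R := fun ρ hρ =>
    ball_subset_closedBall.trans (closedBall_subset_closedBall hρ)
  have hint : ∀ {f g : E (k + 1) → ℝ}, (∀ y ∈ closedBall x R, f y = g y) → ∀ ρ ≤ R,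
      ∫ y in ball x ρ ∩ Ω, f y = ∫ y in ball x ρ, g y := by
    intro f g hfg ρ hρ
    rw [inter_eq_left.2 ((hsub ρ hρ).trans hball)]
    exact setIntegral_congr_fun measurableSet_ball fun y hy => hfg y (hsub ρ hρ hy)
  have hxi : ∫ ρ in Ioo r R, xiPlus ε Ω u (ball x ρ) / ρ ^ (k + 1) =
      (∫ y in ball x R, radialWeight k r R x y * discrepancyPos ε w y) / k := by
    rw [← setIntegral_Ioo_setIntegral_ball_div_pow (by omega) hr hrR x
      (continuous_discrepancyPos ε hw)]
    refine setIntegral_congr_fun measurableSet_Ioo fun ρ hρ => ?_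
    have := hint hdis ρ hρ.2.le
    simp only [xiPlus]
    rw [← this]
    rfl
  have hzpow : ∀ s : ℝ, s ^ ((1 : ℤ) - ((k + 1 : ℕ) : ℤ)) = (s ^ k)⁻¹ := fun s => by
    rw [← zpow_natCast, ← zpow_neg]
    congr 1
    push_cast
    ring
  rw [hxi, hzpow, hzpow, mue, mue, ale, hint harea r hrR.le, hint harea R le_rfl,
    hint hwill R le_rfl]
  have hmain := area_le_of_contDiff hk1 hk2 hε hr hrR hR hw x
  have hc := three_quarters_le_c0
  have hc0 : 0 < c0 := by linarith
  have hX : 0 ≤ (∫ y in ball x R, radialWeight k r R x y * discrepancyPos ε w y) / k :=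
    div_nonneg (setIntegral_nonneg measurableSet_ball fun y _ =>
      mul_nonneg (radialWeight_nonneg hr hrR) (le_max_right _ _)) (by linarith)
  have hF : 0 ≤ (R ^ k)⁻¹ * ∫ y in ball x R, areaDensity ε w y :=
    mul_nonneg (inv_nonneg.2 (pow_nonneg (hr.trans hrR).le k))
      (setIntegral_nonneg measurableSet_ball fun y _ => by
        have := W_nonneg (w y)
        unfold areaDensity
        positivity)
  have hA : 0 ≤ 1 / ε * ∫ y in ball x R, willDensity ε w y :=
    mul_nonneg (one_div_pos.2 hε).le
      (setIntegral_nonneg measurableSet_ball fun y _ => sq_nonneg _)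
  set X := ∫ y in ball x R, radialWeight k r R x y * discrepancyPos ε w y
  set F := ∫ y in ball x R, areaDensity ε w y
  set A := ∫ y in ball x R, willDensity ε w y
  set f := ∫ y in ball x r, areaDensity ε w y
  have hdivided : 2 / 3 * ((r ^ k)⁻¹ * f) ≤ (R ^ k)⁻¹ * F + X / k + 3 / 2 * (1 / ε * A) := by
    refine le_of_mul_le_mul_left ?_ (by linarith : (0 : ℝ) < k)
    have : (k : ℝ) * (X / k) = X := by field_simp
    nlinarith
  have hscaled : (r ^ k)⁻¹ * f ≤
      3 * ((R ^ k)⁻¹ * F) + 3 * (1 / ε * A) + 2 * c0 * (X / k) := by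
    nlinarith
  calc (r ^ k)⁻¹ * (1 / c0 * f) = 1 / c0 * ((r ^ k)⁻¹ * f) := by ring
    _ ≤ 1 / c0 * (3 * ((R ^ k)⁻¹ * F) + 3 * (1 / ε * A) + 2 * c0 * (X / k)) := by gcongr
    _ = 3 * (R ^ k)⁻¹ * (1 / c0 * F) + 3 * (1 / (c0 * ε) * A) + 2 * (X / k) := by
      field_simp

end
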